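/- For every m ≥ 2 the following patterns are all equivalent to each other: (a) the pattern 12⋯(m−1)m(m+1); (b) the pattern 12⋯(m−1)md for every d ∈ {1,…,m}; (c) the pattern 12⋯(m−1)dm for every d ∈ {1,…,m−1}. Here 12⋯(m−1)md denotes the sequence (1,2,…,m−1,m,d), and analogously for the other patterns. -/

import Mathlib

/-- `π` is the canonical sequence of a set partition: every entry is at least 1,
and each entry is at most one more than the maximum of the preceding entries
(so the first entry is 1). -/
def IsCanonicalSeq (π : List ℕ) : Prop :=
  ∀ i (h : i < π.length), 1 ≤ π.get ⟨i, h⟩ ∧ π.get ⟨i, h⟩ ≤ (π.take i).foldr max 0 + 1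

/-- `π` contains the pattern `σ`: there is a subsequence of `π`
order-isomorphic to `σ`. -/
def ContainsPat (π σ : List ℕ) : Prop :=
  ∃ f : Fin σ.length → Fin π.length, StrictMono f ∧
    ∀ i j : Fin σ.length, σ.get i < σ.get j ↔ π.get (f i) < π.get (f j)

/-- `π` avoids the pattern `σ`. -/
def AvoidsPat (π σ : List ℕ) : Prop := ¬ ContainsPat π σ

/-- `pAvoid n σ` is the number of canonical sequences of partitions of `[n]`
avoiding the pattern `σ`. -/
noncomputable def pAvoid (n : ℕ) (σ : List ℕ) : ℕ :=
  Set.ncard {π : List ℕ | π.length = n ∧ IsCanonicalSeq π ∧ AvoidsPat π σ}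

/-- Two patterns are equivalent if they have the same number of avoiders of
each size. -/
def PatEquiv (σ σ' : List ℕ) : Prop := ∀ n, pAvoid n σ = pAvoid n σ'

/-- The increasing sequence `1, 2, …, k`. -/
def iota (k : ℕ) : List ℕ := (List.range k).map (· + 1)


/-- The maximum of a list of natural numbers, with value `0` on the empty list. -/
abbrev listMax (l : List ℕ) : ℕ := l.foldr max 0

theorem listMax_concat (l : List ℕ) (x : ℕ) : listMax (l ++ [x]) = max (listMax l) x := by
  induction l with
  | nil => simp [listMax]
  | cons a l ih =>
    simp only [listMax, List.cons_append, List.foldr_cons] at ih ⊢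
    rw [ih, max_assoc]

theorem le_listMax {l : List ℕ} {x : ℕ} (hx : x ∈ l) : x ≤ listMax l := by
  induction l with
  | nil => simp at hx
  | cons a l ih =>
    simp only [listMax, List.foldr_cons, List.mem_cons] at ih hx ⊢
    grind

theorem isCanonicalSeq_nil : IsCanonicalSeq [] := fun i h => absurd h (by simp)

theorem isCanonicalSeq_concat (l : List ℕ) (x : ℕ) :
    IsCanonicalSeq (l ++ [x]) ↔ IsCanonicalSeq l ∧ 1 ≤ x ∧ x ≤ listMax l + 1 := by
  constructor
  · intro h
    refine ⟨fun i hi => ?_, ?_⟩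
    · have := h i (by simp; omega)
      simpa [List.getElem_append_left hi, List.take_append_of_le_length hi.le] using this
    · simpa using h l.length (by simp)
  · rintro ⟨h, hx⟩ i hi
    rcases (show i < l.length ∨ i = l.length by simp at hi; omega) with hi' | rfl
    · simpa [List.getElem_append_left hi', List.take_append_of_le_length hi'.le] using h i hi'
    · simpa using hx

theorem IsCanonicalSeq.one_le {l : List ℕ} (h : IsCanonicalSeq l) {x : ℕ} (hx : x ∈ l) :
    1 ≤ x := by
  obtain ⟨i, hi, rfl⟩ := List.getElem_of_mem hx
  exact (h i hi).1

theorem iota_succ (k : ℕ) : iota (k + 1) = iota k ++ [k + 1] := by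
  simp [iota, List.range_succ]

theorem mem_iota {k i : ℕ} : i ∈ iota k ↔ 1 ≤ i ∧ i ≤ k := by
  simp only [iota, List.mem_map, List.mem_range]
  constructor
  · rintro ⟨a, ha, rfl⟩
    omega
  · rintro ⟨h1, h2⟩
    exact ⟨i - 1, by omega, by omega⟩

theorem sortedLT_iota (k : ℕ) : (iota k).Pairwise (· < ·) :=
  List.pairwise_map.2 (List.pairwise_lt_range.imp (by simp))

theorem IsCanonicalSeq.iota_sublist {l : List ℕ} (h : IsCanonicalSeq l) :
    (iota (listMax l)).Sublist l := by
  induction l using List.reverseRecOn with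
  | nil => simp [iota, listMax]
  | append_singleton l x ih =>
    obtain ⟨hl, -, hx⟩ := (isCanonicalSeq_concat l x).1 h
    rw [listMax_concat]
    rcases Nat.lt_or_ge (listMax l) x with hlt | hge
    · obtain rfl : x = listMax l + 1 := by omega
      rw [max_eq_right (by omega), iota_succ]
      exact (ih hl).append (List.Sublist.refl _)
    · rw [max_eq_left hge]
      exact (ih hl).trans (List.sublist_append_left _ _)

theorem IsCanonicalSeq.map_iota_sublist_iff {l : List ℕ} (h : IsCanonicalSeq l) {k : ℕ}
    {a : ℕ → ℕ} (ha : StrictMonoOn a (Set.Icc 1 k)) :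
    ((iota k).map a).Sublist l ↔ ∀ i, 1 ≤ i → i ≤ k → 1 ≤ a i ∧ a i ≤ listMax l := by
  constructor
  · intro hs i h1 h2
    have hmem : a i ∈ l := hs.subset (List.mem_map_of_mem (mem_iota.2 ⟨h1, h2⟩))
    exact ⟨h.one_le hmem, le_listMax hmem⟩
  · intro hb
    refine List.Sublist.trans ?_ h.iota_sublist
    have hp : ((iota k).map a).Pairwise (· < ·) :=
      List.pairwise_map.2 ((sortedLT_iota k).imp_of_mem fun {i j} hi hj hij =>
        ha (mem_iota.1 hi) (mem_iota.1 hj) hij)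
    refine List.sublist_of_subperm_of_pairwise (r := (· < ·))
      (List.subperm_of_subset (hp.imp fun h => h.ne) ?_) hp (sortedLT_iota _)
    intro y hy
    obtain ⟨i, hi, rfl⟩ := List.mem_map.1 hy
    rw [mem_iota] at hi ⊢
    exact hb i hi.1 hi.2

theorem containsPat_iff (π σ : List ℕ) :
    ContainsPat π σ ↔
      ∃ a : ℕ → ℕ, StrictMonoOn a {v | v ∈ σ} ∧ (σ.map a).Sublist π := by
  constructor
  · rintro ⟨f, hf, hiso⟩
    have heq : ∀ i j, σ.get i = σ.get j → π.get (f i) = π.get (f j) := fun i j hij =>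
      le_antisymm (not_lt.1 fun h => by have := (hiso j i).2 h; omega)
        (not_lt.1 fun h => by have := (hiso i j).2 h; omega)
    have hex : ∀ v, ∃ y, ∀ i, σ.get i = v → π.get (f i) = y := by
      intro v
      by_cases hv : ∃ i, σ.get i = v
      · obtain ⟨i, hi⟩ := hv
        exact ⟨π.get (f i), fun j hj => heq j i (hj.trans hi.symm)⟩
      · exact ⟨0, fun i hi => absurd ⟨i, hi⟩ hv⟩
    choose a ha using hex
    refine ⟨a, ?_, ?_⟩
    · intro v hv w hw hvw
      obtain ⟨i, rfl⟩ := List.get_of_mem hv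
      obtain ⟨j, rfl⟩ := List.get_of_mem hw
      rw [← ha _ i rfl, ← ha _ j rfl]
      exact (hiso i j).1 hvw
    · rw [List.sublist_iff_exists_fin_orderEmbedding_get_eq]
      refine ⟨(Fin.castOrderIso (by simp)).toOrderEmbedding.trans
        (OrderEmbedding.ofStrictMono f hf), fun i => ?_⟩
      simpa using (ha _ (Fin.cast (by simp) i) rfl).symm
  · rintro ⟨a, ha, hs⟩
    obtain ⟨f, hf⟩ := List.sublist_iff_exists_fin_orderEmbedding_get_eq.1 hs
    refine ⟨fun i => f (Fin.cast (by simp) i), fun i j hij => f.strictMono (by simpa using hij),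
      fun i j => ?_⟩
    rw [← hf, ← hf]
    simpa using (ha.lt_iff_lt (List.get_mem σ i) (List.get_mem σ j)).symm

theorem concat_sublist_concat_iff (s l : List ℕ) (y x : ℕ) :
    (s ++ [y]).Sublist (l ++ [x]) ↔ (s ++ [y]).Sublist l ∨ y = x ∧ s.Sublist l := by
  simp only [← List.reverse_sublist (l₁ := s ++ [y]), ← List.reverse_sublist (l₁ := s),
    List.reverse_append, List.reverse_singleton, List.singleton_append, List.sublist_cons_iff]
  simp [eq_comm]

/-- `l` contains an occurrence of `1 2 ⋯ k d` whose letter playing the role of `k` is at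
most `t`. -/
def RepeatBelow (k d : ℕ) (l : List ℕ) (t : ℕ) : Prop :=
  ∃ a : ℕ → ℕ, StrictMonoOn a (Set.Icc 1 k) ∧ a k ≤ t ∧ ((iota k).map a ++ [a d]).Sublist l

theorem StrictMonoOn.add_sub_le {a : ℕ → ℕ} {k i j : ℕ} (ha : StrictMonoOn a (Set.Icc 1 k))
    (hi : 1 ≤ i) (hij : i ≤ j) (hj : j ≤ k) : a i + (j - i) ≤ a j := by
  induction j, hij using Nat.le_induction with
  | base => simp
  | succ j hij ih =>
    have h1 := ih (by omega)
    have h2 := ha (a := j) (b := j + 1) ⟨by omega, by omega⟩ ⟨by omega, hj⟩ (by omega)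
    omega

theorem not_repeatBelow_nil (k d t : ℕ) : ¬ RepeatBelow k d [] t := by
  rintro ⟨a, -, -, h⟩
  simp at h

theorem IsCanonicalSeq.repeatBelow_concat {l : List ℕ} (h : IsCanonicalSeq l) {k d : ℕ}
    (hd : 1 ≤ d) (hdk : d ≤ k) (x t : ℕ) :
    RepeatBelow k d (l ++ [x]) t ↔
      RepeatBelow k d l t ∨ d ≤ x ∧ x + k - d ≤ t ∧ x + k - d ≤ listMax l := by
  constructor
  · rintro ⟨a, ha, hat, hs⟩
    rw [concat_sublist_concat_iff] at hs
    rcases hs with hs | ⟨rfl, hs⟩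
    · exact Or.inl ⟨a, ha, hat, hs⟩
    · right
      rw [h.map_iota_sublist_iff ha] at hs
      have h1 := ha.add_sub_le hd hdk le_rfl
      have h2 := ha.add_sub_le le_rfl hd hdk
      have h3 := hs 1 le_rfl (by omega)
      have h4 := hs k (by omega) le_rfl
      omega
  · rintro (⟨a, ha, hat, hs⟩ | ⟨h1, h2, h3⟩)
    · exact ⟨a, ha, hat, hs.trans (List.sublist_append_left _ _)⟩
    · have ha : StrictMonoOn (fun i => if i < d then i else x + i - d) (Set.Icc 1 k) := by
        intro i hi j hj hij
        dsimp only
        split_ifs <;> omega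
      refine ⟨_, ha, ?_, (concat_sublist_concat_iff _ _ _ _).2 (Or.inr ⟨?_, ?_⟩)⟩
      · simp only [not_lt.2 hdk, if_false, h2]
      · simp
      · rw [h.map_iota_sublist_iff ha]
        intro i hi1 hi2
        split_ifs <;> omega

theorem IsCanonicalSeq.avoidsPat_iota_iff {l : List ℕ} (h : IsCanonicalSeq l) (m : ℕ) :
    AvoidsPat l (iota (m + 1)) ↔ listMax l ≤ m := by
  have hset : {v | v ∈ iota (m + 1)} = Set.Icc 1 (m + 1) := Set.ext fun v => mem_iota
  rw [AvoidsPat, containsPat_iff, hset, ← not_lt, not_iff_not]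
  constructor
  · rintro ⟨a, ha, hs⟩
    rw [h.map_iota_sublist_iff ha] at hs
    have h1 := ha.add_sub_le le_rfl (show 1 ≤ m + 1 by omega) le_rfl
    have h2 := hs 1 le_rfl (by omega)
    have h3 := hs (m + 1) (by omega) le_rfl
    omega
  · intro hm
    have ha : StrictMonoOn (fun i : ℕ => i) (Set.Icc 1 (m + 1)) := fun i _ j _ hij => hij
    refine ⟨_, ha, (h.map_iota_sublist_iff ha).2 fun i h1 h2 => ⟨h1, by omega⟩⟩

theorem containsPat_iota_concat_iff (l : List ℕ) {m d : ℕ} (hd : 1 ≤ d) (hdm : d ≤ m) :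
    ContainsPat l (iota m ++ [d]) ↔ ∃ t, RepeatBelow m d l t := by
  have hset : {v | v ∈ iota m ++ [d]} = Set.Icc 1 m := by
    ext v
    simp only [List.mem_append, mem_iota, List.mem_singleton, Set.mem_ofPred_eq, Set.mem_Icc]
    omega
  rw [containsPat_iff, hset]
  simp only [List.map_append, List.map_cons, List.map_nil]
  exact ⟨fun ⟨a, ha, hs⟩ => ⟨a m, a, ha, le_rfl, hs⟩, fun ⟨_, a, ha, _, hs⟩ => ⟨a, ha, hs⟩⟩

theorem containsPat_iota_concat_concat {k d : ℕ} (hd : 1 ≤ d) (hdk : d ≤ k) (l : List ℕ)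
    {x : ℕ} (hx : 1 ≤ x) :
    ContainsPat (l ++ [x]) (iota k ++ [d, k + 1]) ↔
      ContainsPat l (iota k ++ [d, k + 1]) ∨ RepeatBelow k d l (x - 1) := by
  have hset : {v | v ∈ iota k ++ [d, k + 1]} = Set.Icc 1 (k + 1) := by
    ext v
    simp only [List.mem_append, mem_iota, List.mem_cons, List.not_mem_nil, or_false,
      Set.mem_ofPred_eq, Set.mem_Icc]
    omega
  have hmap : ∀ a : ℕ → ℕ, (iota k ++ [d, k + 1]).map a
      = ((iota k).map a ++ [a d]) ++ [a (k + 1)] := by simp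
  rw [containsPat_iff, containsPat_iff, hset]
  simp only [hmap, concat_sublist_concat_iff]
  constructor
  · rintro ⟨a, ha, hs | ⟨rfl, hs⟩⟩
    · exact Or.inl ⟨a, ha, hs⟩
    · right
      refine ⟨a, ha.mono (Set.Icc_subset_Icc_right (by omega)), ?_, hs⟩
      have := ha.add_sub_le (show 1 ≤ k by omega) (Nat.le_add_right k 1) le_rfl
      omega
  · rintro (⟨a, ha, hs⟩ | ⟨a, ha, hat, hs⟩)
    · exact ⟨a, ha, Or.inl hs⟩
    · refine ⟨fun i => if i ≤ k then a i else x, ?_, Or.inr ⟨by simp, ?_⟩⟩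
      · intro i hi j hj hij
        simp only [Set.mem_Icc] at hi hj
        dsimp only
        split_ifs with h1 h2 h2
        · exact ha ⟨hi.1, h1⟩ ⟨hj.1, h2⟩ hij
        · have := ha.monotoneOn ⟨hi.1, h1⟩ (b := k) ⟨by omega, le_rfl⟩ h1
          omega
        · omega
        · omega
      · have hcongr : (iota k).map (fun i => if i ≤ k then a i else x) = (iota k).map a :=
          List.map_congr_left fun i hi => if_pos (mem_iota.1 hi).2
        rw [hcongr]
        simpa only [hdk, if_true] using hs

theorem IsCanonicalSeq.le_of_repeatBelow {l : List ℕ} (h : IsCanonicalSeq l) {k d t : ℕ}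
    (hk : 1 ≤ k) (hl : RepeatBelow k d l t) : k ≤ t ∧ k ≤ listMax l := by
  obtain ⟨a, ha, hat, hs⟩ := hl
  have hs' := (h.map_iota_sublist_iff ha).1 ((List.sublist_append_left _ _).trans hs)
  have h1 := ha.add_sub_le le_rfl hk le_rfl
  have h2 := hs' 1 le_rfl hk
  have h3 := hs' k hk le_rfl
  omega

theorem AvoidsPat.of_concat {l σ : List ℕ} {x : ℕ} (h : AvoidsPat (l ++ [x]) σ) :
    AvoidsPat l σ := by
  intro hc
  obtain ⟨a, ha, hs⟩ := (containsPat_iff _ _).1 hc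
  exact h ((containsPat_iff _ _).2 ⟨a, ha, hs.trans (List.sublist_append_left _ _)⟩)

theorem avoidsPat_nil {σ : List ℕ} (hσ : σ ≠ []) : AvoidsPat [] σ := by
  intro hc
  obtain ⟨a, -, hs⟩ := (containsPat_iff _ _).1 hc
  simp [hσ] at hs

/-- `l` is a canonical sequence avoiding `σ`. -/
def CanonicalAvoider (σ l : List ℕ) : Prop := IsCanonicalSeq l ∧ AvoidsPat l σ

open Classical in
/-- The letters that can be appended to `l` to produce a canonical sequence avoiding `σ`. -/
noncomputable def avoidSteps (σ l : List ℕ) : Finset ℕ :=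
  {x ∈ Finset.Icc 1 (listMax l + 1) | AvoidsPat (l ++ [x]) σ}

/-- The number of ways to append `r` letters to `l`, one at a time, within the canonical
sequences avoiding `σ`. -/
noncomputable def avoidExtCount (σ : List ℕ) : ℕ → List ℕ → ℕ
  | 0, _ => 1
  | r + 1, l => ∑ x ∈ avoidSteps σ l, avoidExtCount σ r (l ++ [x])

theorem mem_avoidSteps {σ l : List ℕ} {x : ℕ} :
    x ∈ avoidSteps σ l ↔ (1 ≤ x ∧ x ≤ listMax l + 1) ∧ AvoidsPat (l ++ [x]) σ := by
  simp [avoidSteps]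

theorem canonicalAvoider_concat {σ l : List ℕ} {x : ℕ} :
    CanonicalAvoider σ (l ++ [x]) ↔ CanonicalAvoider σ l ∧ x ∈ avoidSteps σ l := by
  rw [CanonicalAvoider, CanonicalAvoider, isCanonicalSeq_concat, mem_avoidSteps]
  exact ⟨fun ⟨⟨h1, h2⟩, h3⟩ => ⟨⟨h1, h3.of_concat⟩, h2, h3⟩,
    fun ⟨⟨h1, _⟩, h2, h3⟩ => ⟨⟨h1, h2⟩, h3⟩⟩

theorem CanonicalAvoider.of_append {σ l w : List ℕ} (h : CanonicalAvoider σ (l ++ w)) :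
    CanonicalAvoider σ l := by
  induction w using List.reverseRecOn with
  | nil => simpa using h
  | append_singleton w x ih =>
    rw [← List.append_assoc, canonicalAvoider_concat] at h
    exact ih h.1

theorem exists_finset_card_eq_avoidExtCount (σ : List ℕ) (r : ℕ) (l : List ℕ)
    (hl : CanonicalAvoider σ l) :
    ∃ S : Finset (List ℕ), S.card = avoidExtCount σ r l ∧
      ∀ w, w ∈ S ↔ w.length = r ∧ CanonicalAvoider σ (l ++ w) := by
  induction r generalizing l with
  | zero =>
    refine ⟨{[]}, by simp [avoidExtCount], fun w => ?_⟩
    simp only [Finset.mem_singleton, List.length_eq_zero_iff]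
    exact ⟨fun h => ⟨h, by simpa [h] using hl⟩, fun h => h.1⟩
  | succ r ih =>
    have hstep : ∀ x, ∃ S : Finset (List ℕ), x ∈ avoidSteps σ l →
        S.card = avoidExtCount σ r (l ++ [x]) ∧
        ∀ w, w ∈ S ↔ w.length = r ∧ CanonicalAvoider σ (l ++ [x] ++ w) := by
      intro x
      by_cases hx : x ∈ avoidSteps σ l
      · obtain ⟨S, hS⟩ := ih _ (canonicalAvoider_concat.2 ⟨hl, hx⟩)
        exact ⟨S, fun _ => hS⟩
      · exact ⟨∅, fun h => absurd h hx⟩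
    choose S hS using hstep
    refine ⟨(avoidSteps σ l).biUnion fun x => (S x).image (List.cons x), ?_, fun w => ?_⟩
    · rw [Finset.card_biUnion, avoidExtCount]
      · refine Finset.sum_congr rfl fun x hx => ?_
        rw [Finset.card_image_of_injective _ List.cons_injective, (hS x hx).1]
      · intro x _ y _ hxy
        refine Finset.disjoint_left.2 fun w hw hw' => ?_
        simp only [Finset.mem_image] at hw hw'
        obtain ⟨u, -, rfl⟩ := hw
        obtain ⟨v, -, hv⟩ := hw'
        exact hxy (List.cons.inj hv).1.symm
    · simp only [Finset.mem_biUnion, Finset.mem_image]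
      constructor
      · rintro ⟨x, hx, u, hu, rfl⟩
        have := ((hS x hx).2 u).1 hu
        simpa using this
      · rintro ⟨hlen, hw⟩
        obtain _ | ⟨x, u⟩ := w
        · simp at hlen
        · rw [List.append_cons] at hw
          have hx := (canonicalAvoider_concat.1 hw.of_append).2
          exact ⟨x, hx, u, ((hS x hx).2 u).2 ⟨by simpa using hlen, hw⟩, rfl⟩

theorem pAvoid_eq_avoidExtCount {σ : List ℕ} (hσ : σ ≠ []) (n : ℕ) :
    pAvoid n σ = avoidExtCount σ n [] := by
  obtain ⟨S, hS, hmem⟩ := exists_finset_card_eq_avoidExtCount σ n []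
    ⟨isCanonicalSeq_nil, avoidsPat_nil hσ⟩
  rw [← hS, pAvoid, ← Set.ncard_coe_finset]
  congr 1
  ext w
  simp [hmem, CanonicalAvoider]

/-- The number of canonical continuations of length `r` of a sequence with maximum `M`, where
`M` letters can be repeated as long as `M < k`, and there are `k + 1` choices for every letter
once the maximum reaches `k`. -/
def saturatedCount (k : ℕ) : ℕ → ℕ → ℕ
  | 0, _ => 1
  | r + 1, M =>
    if M < k then M * saturatedCount k r M + saturatedCount k r (M + 1) else (k + 1) ^ (r + 1)

theorem avoidExtCount_eq_saturatedCount {σ : List ℕ} {k : ℕ}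
    (hfree : ∀ l x, CanonicalAvoider σ l → listMax l < k → 1 ≤ x → x ≤ listMax l + 1 →
      AvoidsPat (l ++ [x]) σ)
    (hsat : ∀ l, CanonicalAvoider σ l → CanonicalAvoider σ (l ++ [k]) → listMax l + 1 = k →
      ∀ r, avoidExtCount σ r (l ++ [k]) = (k + 1) ^ r)
    (r : ℕ) (l : List ℕ) (hl : CanonicalAvoider σ l) (hlk : listMax l < k) :
    avoidExtCount σ r l = saturatedCount k r (listMax l) := by
  induction r generalizing l with
  | zero => rfl
  | succ r ih =>
    have hsteps : avoidSteps σ l = Finset.Icc 1 (listMax l + 1) := by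
      ext x
      rw [mem_avoidSteps, Finset.mem_Icc]
      exact ⟨fun h => h.1, fun h => ⟨h, hfree l x hl hlk h.1 h.2⟩⟩
    have hchild : ∀ x, 1 ≤ x → x ≤ listMax l + 1 → CanonicalAvoider σ (l ++ [x]) :=
      fun x h1 h2 => canonicalAvoider_concat.2 ⟨hl, by simp [hsteps, h1, h2]⟩
    rw [avoidExtCount, saturatedCount, if_pos hlk, hsteps, Finset.sum_Icc_succ_top (by omega)]
    congr 1
    · rw [Finset.sum_congr rfl (g := fun _ => saturatedCount k r (listMax l))]
      · simp
      · intro x hx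
        rw [Finset.mem_Icc] at hx
        have hmax : listMax (l ++ [x]) = listMax l := by
          rw [listMax_concat, max_eq_left hx.2]
        rw [ih _ (hchild x hx.1 (by omega)) (by omega), hmax]
    · have hmax : listMax (l ++ [listMax l + 1]) = listMax l + 1 := by
        rw [listMax_concat, max_eq_right (by omega)]
      have hc := hchild (listMax l + 1) (by omega) le_rfl
      rcases Nat.lt_or_ge (listMax l + 1) k with hlt | hge
      · rw [ih _ hc (by omega), hmax]
      · obtain rfl : listMax l + 1 = k := by omega
        rw [hsat l hl hc rfl]
        cases r <;> simp [saturatedCount]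

theorem pAvoid_eq_saturatedCount {σ : List ℕ} {k : ℕ} (hk : 1 ≤ k) (hσ : σ ≠ [])
    (hfree : ∀ l x, CanonicalAvoider σ l → listMax l < k → 1 ≤ x → x ≤ listMax l + 1 →
      AvoidsPat (l ++ [x]) σ)
    (hsat : ∀ l, CanonicalAvoider σ l → CanonicalAvoider σ (l ++ [k]) → listMax l + 1 = k →
      ∀ r, avoidExtCount σ r (l ++ [k]) = (k + 1) ^ r) (n : ℕ) :
    pAvoid n σ = saturatedCount k n 0 := by
  rw [pAvoid_eq_avoidExtCount hσ]
  exact avoidExtCount_eq_saturatedCount hfree hsat n []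
    ⟨isCanonicalSeq_nil, avoidsPat_nil hσ⟩ hk

theorem avoidExtCount_eq_pow {σ : List ℕ} {k : ℕ}
    (hcard : ∀ l, CanonicalAvoider σ l → k ≤ listMax l → (avoidSteps σ l).card = k + 1)
    (r : ℕ) (l : List ℕ) (hl : CanonicalAvoider σ l) (hlk : k ≤ listMax l) :
    avoidExtCount σ r l = (k + 1) ^ r := by
  induction r generalizing l with
  | zero => rfl
  | succ r ih =>
    rw [avoidExtCount, Finset.sum_congr rfl (g := fun _ => (k + 1) ^ r)]
    · rw [Finset.sum_const, hcard l hl hlk, smul_eq_mul, pow_succ']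
    · exact fun x hx => ih _ (canonicalAvoider_concat.2 ⟨hl, hx⟩)
        (by rw [listMax_concat]; exact le_max_of_le_left hlk)

theorem le_listMax_concat (l : List ℕ) (x : ℕ) : x ≤ listMax (l ++ [x]) := by
  rw [listMax_concat]
  exact le_max_right _ _

theorem pAvoid_iota {k : ℕ} (hk : 1 ≤ k) (n : ℕ) :
    pAvoid n (iota (k + 1 + 1)) = saturatedCount k n 0 := by
  have havoid : ∀ l x, IsCanonicalSeq l → 1 ≤ x → x ≤ listMax l + 1 →
      (AvoidsPat (l ++ [x]) (iota (k + 1 + 1)) ↔ max (listMax l) x ≤ k + 1) := by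
    intro l x hl h1 h2
    rw [((isCanonicalSeq_concat l x).2 ⟨hl, h1, h2⟩).avoidsPat_iota_iff, listMax_concat]
  refine pAvoid_eq_saturatedCount hk (by simp [iota]) (fun l x hl hlk h1 h2 => ?_)
    (fun l _ hlk _ r => avoidExtCount_eq_pow (fun l hl hlk => ?_) r _ hlk
      (le_listMax_concat l k)) n
  · rw [havoid l x hl.1 h1 h2]
    omega
  · have hmax := (hl.1.avoidsPat_iota_iff _).1 hl.2
    have hsteps : avoidSteps (iota (k + 1 + 1)) l = Finset.Icc 1 (k + 1) := by
      ext x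
      rw [mem_avoidSteps, Finset.mem_Icc]
      constructor
      · rintro ⟨⟨h1, h2⟩, h3⟩
        rw [havoid l x hl.1 h1 h2] at h3
        omega
      · rintro ⟨h1, h2⟩
        have h3 : x ≤ listMax l + 1 := by omega
        refine ⟨⟨h1, h3⟩, ?_⟩
        rw [havoid l x hl.1 h1 h3]
        omega
    simp [hsteps]

theorem pAvoid_iota_concat {k d : ℕ} (hk : 1 ≤ k) (hd : 1 ≤ d) (hdk : d ≤ k + 1) (n : ℕ) :
    pAvoid n (iota (k + 1) ++ [d]) = saturatedCount k n 0 := by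
  have havoid : ∀ l x, CanonicalAvoider (iota (k + 1) ++ [d]) l →
      (AvoidsPat (l ++ [x]) (iota (k + 1) ++ [d]) ↔
        ¬ (d ≤ x ∧ x + (k + 1) - d ≤ listMax l)) := by
    intro l x hl
    have hno : ∀ t, ¬ RepeatBelow (k + 1) d l t := fun t ht =>
      hl.2 ((containsPat_iota_concat_iff l hd hdk).2 ⟨t, ht⟩)
    rw [AvoidsPat, containsPat_iota_concat_iff _ hd hdk, not_iff_not]
    simp only [hl.1.repeatBelow_concat hd hdk, hno, false_or]
    exact ⟨fun ⟨t, h1, _, h2⟩ => ⟨h1, h2⟩, fun ⟨h1, h2⟩ => ⟨_, h1, h2, h2⟩⟩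
  refine pAvoid_eq_saturatedCount hk (by simp) (fun l x hl hlk h1 h2 => ?_)
    (fun l _ hlk _ r => avoidExtCount_eq_pow (fun l hl hlk => ?_) r _ hlk
      (le_listMax_concat l k)) n
  · rw [havoid l x hl]
    omega
  · have hsteps : avoidSteps (iota (k + 1) ++ [d]) l =
        Finset.Icc 1 (listMax l + 1) \ Finset.Icc d (listMax l + d - (k + 1)) := by
      ext x
      rw [mem_avoidSteps, Finset.mem_sdiff, Finset.mem_Icc, Finset.mem_Icc, havoid l x hl]
      omega
    rw [hsteps, Finset.card_sdiff_of_subset, Nat.card_Icc, Nat.card_Icc]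
    · omega
    · intro x
      simp only [Finset.mem_Icc]
      omega

/-- The number of continuations of length `r` avoiding `1 2 ⋯ k d (k + 1)` of a sequence which
forces all further letters to be at most `t`. -/
def cappedCount (k : ℕ) : ℕ → ℕ → ℕ
  | 0, _ => 1
  | r + 1, t => (k - 1) * cappedCount k r t + ∑ s ∈ Finset.Icc k t, cappedCount k r s

/-- The number of continuations of length `r` avoiding `1 2 ⋯ k d (k + 1)` of a sequence with
maximum `M` without an occurrence of `1 2 ⋯ k d`. -/
def uncappedCount (k : ℕ) : ℕ → ℕ → ℕ
  | 0, _ => 1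
  | r + 1, M => (k - 1) * uncappedCount k r M + ∑ s ∈ Finset.Icc k M, cappedCount k r s +
      uncappedCount k r (M + 1)

theorem uncappedCount_succ_add_cappedCount (k r M : ℕ) (hM : k ≤ M) :
    uncappedCount k r (M + 1) + cappedCount k r M = 2 * uncappedCount k r M := by
  induction r generalizing M with
  | zero => rfl
  | succ r ih =>
    have h1 := congrArg ((k - 1) * ·) (ih M hM)
    have h2 := ih (M + 1) (by omega)
    simp only [uncappedCount, cappedCount, Finset.sum_Icc_succ_top (show k ≤ M + 1 by omega)]
    rw [mul_add] at h1
    linarith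

theorem uncappedCount_self (k r : ℕ) (hk : 1 ≤ k) : uncappedCount k r k = (k + 1) ^ r := by
  induction r with
  | zero => rfl
  | succ r ih =>
    have h := uncappedCount_succ_add_cappedCount k r k le_rfl
    obtain ⟨c, rfl⟩ := Nat.exists_eq_add_of_le' hk
    rw [uncappedCount, Finset.Icc_self, Finset.sum_singleton, pow_succ', ← ih,
      Nat.add_sub_cancel]
    linarith

theorem sum_Icc_ite_shift {k d N : ℕ} (hd : 1 ≤ d) (hdk : d ≤ k) (hN : k ≤ N) (c : ℕ)
    (g : ℕ → ℕ) :
    ∑ x ∈ Finset.Icc 1 N, (if d ≤ x ∧ x + k - d ≤ N then g (x + k - d) else c) =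
      (k - 1) * c + ∑ s ∈ Finset.Icc k N, g s := by
  have hfilter : {x ∈ Finset.Icc 1 N | d ≤ x ∧ x + k - d ≤ N} = Finset.Icc d (N + d - k) := by
    ext x
    simp only [Finset.mem_filter, Finset.mem_Icc]
    omega
  have hcard : ({x ∈ Finset.Icc 1 N | ¬ (d ≤ x ∧ x + k - d ≤ N)} : Finset ℕ).card = k - 1 := by
    have h := Finset.card_filter_add_card_filter_not (s := Finset.Icc 1 N)
      (fun x => d ≤ x ∧ x + k - d ≤ N)
    rw [hfilter, Nat.card_Icc, Nat.card_Icc] at h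
    omega
  rw [Finset.sum_ite, Finset.sum_const, hcard, hfilter, smul_eq_mul, add_comm ((k - 1) * c)]
  congr 1
  refine Finset.sum_bij' (fun x _ => x + k - d) (fun s _ => s + d - k) ?_ ?_ ?_ ?_ ?_ <;>
    simp only [Finset.mem_Icc] <;> intros <;> first | trivial | omega

section RepeatThenLarger

variable {k d : ℕ}

theorem CanonicalAvoider.mem_avoidSteps_iff (hd : 1 ≤ d) (hdk : d ≤ k) {l : List ℕ}
    (hl : CanonicalAvoider (iota k ++ [d, k + 1]) l) {x : ℕ} :
    x ∈ avoidSteps (iota k ++ [d, k + 1]) l ↔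
      (1 ≤ x ∧ x ≤ listMax l + 1) ∧ ¬ RepeatBelow k d l (x - 1) := by
  rw [mem_avoidSteps]
  refine and_congr_right fun h => ?_
  rw [AvoidsPat, containsPat_iota_concat_concat hd hdk l h.1]
  exact ⟨fun h h' => h (Or.inr h'), fun h h' => h'.elim hl.2 h⟩

theorem avoidExtCount_eq_cappedCount (hd : 1 ≤ d) (hdk : d ≤ k) (r : ℕ) (l : List ℕ)
    (hl : CanonicalAvoider (iota k ++ [d, k + 1]) l) (t₀ : ℕ) (hk : k ≤ t₀)
    (ht₀ : t₀ ≤ listMax l) (hrep : ∀ t, RepeatBelow k d l t ↔ t₀ ≤ t) :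
    avoidExtCount (iota k ++ [d, k + 1]) r l = cappedCount k r t₀ := by
  induction r generalizing l t₀ with
  | zero => rfl
  | succ r ih =>
    have hsteps : avoidSteps (iota k ++ [d, k + 1]) l = Finset.Icc 1 t₀ := by
      ext x
      rw [hl.mem_avoidSteps_iff hd hdk, hrep, Finset.mem_Icc]
      omega
    rw [avoidExtCount, cappedCount, hsteps, ← sum_Icc_ite_shift hd hdk hk]
    refine Finset.sum_congr rfl fun x hx => ?_
    have hchild := canonicalAvoider_concat.2 ⟨hl, hsteps ▸ hx⟩
    rw [Finset.mem_Icc] at hx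
    have hmax := listMax_concat l x
    split_ifs with hc
    · refine ih _ hchild _ (by omega) (by omega) fun t => ?_
      rw [hl.1.repeatBelow_concat hd hdk, hrep]
      omega
    · refine ih _ hchild _ hk (by omega) fun t => ?_
      rw [hl.1.repeatBelow_concat hd hdk, hrep]
      omega

theorem avoidExtCount_eq_uncappedCount (hd : 1 ≤ d) (hdk : d ≤ k) (r : ℕ) (l : List ℕ)
    (hl : CanonicalAvoider (iota k ++ [d, k + 1]) l) (hk : k ≤ listMax l)
    (hrep : ∀ t, ¬ RepeatBelow k d l t) :
    avoidExtCount (iota k ++ [d, k + 1]) r l = uncappedCount k r (listMax l) := by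
  induction r generalizing l with
  | zero => rfl
  | succ r ih =>
    have hsteps : avoidSteps (iota k ++ [d, k + 1]) l = Finset.Icc 1 (listMax l + 1) := by
      ext x
      rw [hl.mem_avoidSteps_iff hd hdk, Finset.mem_Icc]
      exact ⟨fun h => h.1, fun h => ⟨h, hrep _⟩⟩
    have hchild : ∀ x, 1 ≤ x → x ≤ listMax l + 1 →
        CanonicalAvoider (iota k ++ [d, k + 1]) (l ++ [x]) :=
      fun x h1 h2 => canonicalAvoider_concat.2 ⟨hl, by simp [hsteps, h1, h2]⟩
    rw [avoidExtCount, uncappedCount, hsteps, Finset.sum_Icc_succ_top (by omega),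
      ← sum_Icc_ite_shift hd hdk hk]
    congr 1
    · refine Finset.sum_congr rfl fun x hx => ?_
      rw [Finset.mem_Icc] at hx
      have hmax : listMax (l ++ [x]) = listMax l := by
        rw [listMax_concat, max_eq_left hx.2]
      split_ifs with hc
      · refine avoidExtCount_eq_cappedCount hd hdk r _ (hchild x hx.1 (by omega)) _ (by omega)
          (by omega) fun t => ?_
        have := hrep t
        rw [hl.1.repeatBelow_concat hd hdk]
        grind
      · rw [ih _ (hchild x hx.1 (by omega)) (by omega), hmax]
        intro t
        have := hrep t
        rw [hl.1.repeatBelow_concat hd hdk]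
        grind
    · have hmax : listMax (l ++ [listMax l + 1]) = listMax l + 1 := by
        rw [listMax_concat, max_eq_right (by omega)]
      rw [ih _ (hchild _ (by omega) le_rfl) (by omega), hmax]
      intro t
      rw [hl.1.repeatBelow_concat hd hdk]
      rintro (h | h)
      · exact hrep t h
      · omega

theorem pAvoid_iota_concat_concat (hd : 1 ≤ d) (hdk : d ≤ k) (n : ℕ) :
    pAvoid n (iota k ++ [d, k + 1]) = saturatedCount k n 0 := by
  have hk : 1 ≤ k := hd.trans hdk
  refine pAvoid_eq_saturatedCount hk (by simp) (fun l x hl hlk h1 h2 => ?_)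
    (fun l hl hlk hmax r => ?_) n
  · refine (mem_avoidSteps.1 ((hl.mem_avoidSteps_iff hd hdk).2 ⟨⟨h1, h2⟩, fun h => ?_⟩)).2
    have := (hl.1.le_of_repeatBelow hk h).2
    omega
  · have hmax' : listMax (l ++ [k]) = k := by
      rw [listMax_concat]
      omega
    rw [avoidExtCount_eq_uncappedCount hd hdk r _ hlk hmax'.ge, hmax', uncappedCount_self k r hk]
    intro t
    rw [hl.1.repeatBelow_concat hd hdk]
    rintro (h | h)
    · have := (hl.1.le_of_repeatBelow hk h).2
      omega
    · omega

end RepeatThenLarger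

/-- For m ≥ 2 the patterns 12⋯(m−1)m(m+1), 12⋯(m−1)md
(for 1 ≤ d ≤ m) and 12⋯(m−1)dm (for 1 ≤ d ≤ m−1) are all equivalent.
(All of them are stated to be equivalent to the first one, from which pairwise
equivalence follows by transitivity.) -/
theorem statement6 (m : ℕ) (hm : 2 ≤ m) :
    (∀ d : ℕ, 1 ≤ d → d ≤ m → PatEquiv (iota (m + 1)) (iota m ++ [d])) ∧
    (∀ d : ℕ, 1 ≤ d → d ≤ m - 1 → PatEquiv (iota (m + 1)) (iota (m - 1) ++ [d, m])) := by
  obtain ⟨k, rfl⟩ := Nat.exists_eq_add_of_le' (show 1 ≤ m by omega)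
  have hk : 1 ≤ k := by omega
  refine ⟨fun d hd hdm n => ?_, fun d hd hdm n => ?_⟩
  · rw [pAvoid_iota hk, pAvoid_iota_concat hk hd hdm]
  · rw [Nat.add_sub_cancel] at hdm ⊢
    rw [pAvoid_iota hk, pAvoid_iota_concat_concat hd hdm]
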